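/- arXiv:2102.00296 — 3 statements merged into one kernel-verified Lean document; each statement's English description precedes it below -/
import Mathlib

section
/- For any infinite, non-compact Hausdorff space X, the following are equivalent: (a) X is k-Lindelöf; (b) 𝕂(X) is k-Lindelöf; (c) 𝕂(X) is Lindelöf. -/
open Set

section Covers

variable (Y : Type*) [TopologicalSpace Y]

/-- The collection `𝒯_Y` of proper nonempty open subsets of `Y`. -/
def ProperNonemptyOpens : Set (Set Y) :=
  {U | IsOpen U ∧ U.Nonempty ∧ U ≠ Set.univ}

/-- A non-trivial open cover: an open cover not containing the whole space. -/
def IsNontrivialOpenCover (𝒰 : Set (Set Y)) : Prop :=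
  (∀ U ∈ 𝒰, IsOpen U) ∧ ⋃₀ 𝒰 = Set.univ ∧ Set.univ ∉ 𝒰

/-- An ω-cover: a non-trivial open cover such that every finite subset of the
space is contained in some member. -/
def IsOmegaCover (𝒰 : Set (Set Y)) : Prop :=
  IsNontrivialOpenCover Y 𝒰 ∧ ∀ F : Set Y, F.Finite → ∃ U ∈ 𝒰, F ⊆ U

/-- A k-cover: a non-trivial open cover such that every compact proper subset of
the space is contained in some member. -/
def IsKCover (𝒰 : Set (Set Y)) : Prop :=
  IsNontrivialOpenCover Y 𝒰 ∧ ∀ K : Set Y, IsCompact K → K ≠ Set.univ → ∃ U ∈ 𝒰, K ⊆ U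

/-- An `𝒜`-cover: a non-trivial open cover such that every `A ∈ 𝒜` is contained
in some member. -/
def IsACover (𝒜 𝒰 : Set (Set Y)) : Prop :=
  IsNontrivialOpenCover Y 𝒰 ∧ ∀ A ∈ 𝒜, ∃ U ∈ 𝒰, A ⊆ U

/-- `O_Y`: the collection of non-trivial open covers of `Y`. -/
def openCovers : Set (Set (Set Y)) := {𝒰 | IsNontrivialOpenCover Y 𝒰}

/-- `Ω_Y`: the collection of ω-covers of `Y`. -/
def omegaCovers : Set (Set (Set Y)) := {𝒰 | IsOmegaCover Y 𝒰}

/-- `K_Y`: the collection of k-covers of `Y`. -/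
def kCovers : Set (Set (Set Y)) := {𝒰 | IsKCover Y 𝒰}

/-- `O(Y,𝒜)`: the collection of `𝒜`-covers of `Y`. -/
def aCovers (𝒜 : Set (Set Y)) : Set (Set (Set Y)) := {𝒰 | IsACover Y 𝒜 𝒰}

/-- Lindelöf: every open cover has a countable subcover. -/
def IsLindelofSp : Prop :=
  ∀ 𝒰 : Set (Set Y), (∀ U ∈ 𝒰, IsOpen U) → ⋃₀ 𝒰 = Set.univ →
    ∃ 𝒱 ⊆ 𝒰, 𝒱.Countable ∧ ⋃₀ 𝒱 = Set.univ

/-- ε-space: every ω-cover has a countable subset which is still an ω-cover. -/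
def IsEpsilonSpace : Prop :=
  ∀ 𝒰 : Set (Set Y), IsOmegaCover Y 𝒰 → ∃ 𝒱 ⊆ 𝒰, 𝒱.Countable ∧ IsOmegaCover Y 𝒱

/-- k-Lindelöf: every k-cover has a countable subset which is still a k-cover. -/
def IsKLindelof : Prop :=
  ∀ 𝒰 : Set (Set Y), IsKCover Y 𝒰 → ∃ 𝒱 ⊆ 𝒰, 𝒱.Countable ∧ IsKCover Y 𝒱

end Covers

section Games

variable {ι κ : Type*}

/-- The selection principle `S_1(A, B)`. -/
def S1 (A B : Set (Set ι)) : Prop :=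
  ∀ a : ℕ → Set ι, (∀ n, a n ∈ A) →
    ∃ x : ℕ → ι, (∀ n, x n ∈ a n) ∧ Set.range x ∈ B

/-- The selection principle `S_fin(A, B)`. -/
def Sfin (A B : Set (Set ι)) : Prop :=
  ∀ a : ℕ → Set ι, (∀ n, a n ∈ A) →
    ∃ F : ℕ → Set ι, (∀ n, F n ⊆ a n ∧ (F n).Finite) ∧ (⋃ n, F n) ∈ B

/-- One has a winning (full-information) strategy in the single-selection game
`G_1(A, B)`: a function from finite sequences of Two's moves into `A` such that
every legal run produces a set of Two's selections which is not in `B`. -/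
def OneWin1 (A B : Set (Set ι)) : Prop :=
  ∃ σ : List ι → Set ι, (∀ h, σ h ∈ A) ∧
    ∀ x : ℕ → ι, (∀ n, x n ∈ σ (List.ofFn fun i : Fin n => x i)) → Set.range x ∉ B

/-- One has a winning predetermined strategy in `G_1(A, B)`. -/
def OnePre1 (A B : Set (Set ι)) : Prop :=
  ∃ σ : ℕ → Set ι, (∀ n, σ n ∈ A) ∧
    ∀ x : ℕ → ι, (∀ n, x n ∈ σ n) → Set.range x ∉ B

/-- One has a winning constant strategy in `G_1(A, B)`. -/
def OneConst1 (A B : Set (Set ι)) : Prop :=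
  ∃ A₀ ∈ A, ∀ x : ℕ → ι, (∀ n, x n ∈ A₀) → Set.range x ∉ B

/-- Two has a winning (full-information) strategy in `G_1(A, B)`. -/
def TwoWin1 (A B : Set (Set ι)) : Prop :=
  ∃ τ : List (Set ι) → ι, ∀ a : ℕ → Set ι, (∀ n, a n ∈ A) →
    (∀ n, τ (List.ofFn fun i : Fin (n + 1) => a i) ∈ a n) ∧
    Set.range (fun n => τ (List.ofFn fun i : Fin (n + 1) => a i)) ∈ B

/-- Two has a winning Markov strategy in `G_1(A, B)`. -/
def TwoMarkov1 (A B : Set (Set ι)) : Prop :=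
  ∃ τ : Set ι → ℕ → ι, ∀ a : ℕ → Set ι, (∀ n, a n ∈ A) →
    (∀ n, τ (a n) n ∈ a n) ∧ Set.range (fun n => τ (a n) n) ∈ B

/-- One has a winning (full-information) strategy in the finite-selection game
`G_fin(A, B)`. -/
def OneWinFin (A B : Set (Set ι)) : Prop :=
  ∃ σ : List (Set ι) → Set ι, (∀ h, σ h ∈ A) ∧
    ∀ F : ℕ → Set ι,
      (∀ n, F n ⊆ σ (List.ofFn fun i : Fin n => F i) ∧ (F n).Finite) →
      (⋃ n, F n) ∉ B

/-- One has a winning predetermined strategy in `G_fin(A, B)`. -/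
def OnePreFin (A B : Set (Set ι)) : Prop :=
  ∃ σ : ℕ → Set ι, (∀ n, σ n ∈ A) ∧
    ∀ F : ℕ → Set ι, (∀ n, F n ⊆ σ n ∧ (F n).Finite) → (⋃ n, F n) ∉ B

/-- One has a winning constant strategy in `G_fin(A, B)`. -/
def OneConstFin (A B : Set (Set ι)) : Prop :=
  ∃ A₀ ∈ A, ∀ F : ℕ → Set ι, (∀ n, F n ⊆ A₀ ∧ (F n).Finite) → (⋃ n, F n) ∉ B

/-- Two has a winning (full-information) strategy in `G_fin(A, B)`. -/
def TwoWinFin (A B : Set (Set ι)) : Prop :=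
  ∃ τ : List (Set ι) → Set ι, ∀ a : ℕ → Set ι, (∀ n, a n ∈ A) →
    (∀ n, τ (List.ofFn fun i : Fin (n + 1) => a i) ⊆ a n ∧
      (τ (List.ofFn fun i : Fin (n + 1) => a i)).Finite) ∧
    (⋃ n, τ (List.ofFn fun i : Fin (n + 1) => a i)) ∈ B

/-- Two has a winning Markov strategy in `G_fin(A, B)`. -/
def TwoMarkovFin (A B : Set (Set ι)) : Prop :=
  ∃ τ : Set ι → ℕ → Set ι, ∀ a : ℕ → Set ι, (∀ n, a n ∈ A) →
    (∀ n, τ (a n) n ⊆ a n ∧ (τ (a n) n).Finite) ∧ (⋃ n, τ (a n) n) ∈ B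

/-- `G_1(A,C) ≤_II G_1(B,D)`. -/
def LeTwo1 (A C : Set (Set ι)) (B D : Set (Set κ)) : Prop :=
  (TwoMarkov1 A C → TwoMarkov1 B D) ∧
  (TwoWin1 A C → TwoWin1 B D) ∧
  (¬ OneWin1 A C → ¬ OneWin1 B D) ∧
  (¬ OnePre1 A C → ¬ OnePre1 B D) ∧
  (¬ OneConst1 A C → ¬ OneConst1 B D)

/-- `G_fin(A,C) ≤_II G_fin(B,D)`. -/
def LeTwoFin (A C : Set (Set ι)) (B D : Set (Set κ)) : Prop :=
  (TwoMarkovFin A C → TwoMarkovFin B D) ∧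
  (TwoWinFin A C → TwoWinFin B D) ∧
  (¬ OneWinFin A C → ¬ OneWinFin B D) ∧
  (¬ OnePreFin A C → ¬ OnePreFin B D) ∧
  (¬ OneConstFin A C → ¬ OneConstFin B D)

/-- `G_1(A,C) ≡ G_1(B,D)`. -/
def Equiv1 (A C : Set (Set ι)) (B D : Set (Set κ)) : Prop :=
  (TwoMarkov1 A C ↔ TwoMarkov1 B D) ∧
  (TwoWin1 A C ↔ TwoWin1 B D) ∧
  (OneWin1 A C ↔ OneWin1 B D) ∧
  (OnePre1 A C ↔ OnePre1 B D) ∧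
  (OneConst1 A C ↔ OneConst1 B D)

/-- `G_fin(A,C) ≡ G_fin(B,D)`. -/
def EquivFin (A C : Set (Set ι)) (B D : Set (Set κ)) : Prop :=
  (TwoMarkovFin A C ↔ TwoMarkovFin B D) ∧
  (TwoWinFin A C ↔ TwoWinFin B D) ∧
  (OneWinFin A C ↔ OneWinFin B D) ∧
  (OnePreFin A C ↔ OnePreFin B D) ∧
  (OneConstFin A C ↔ OneConstFin B D)

end Games

section Hyperspace

variable (X : Type*) [TopologicalSpace X]

/-- `𝕂(X)`: the nonempty compact subsets of `X`. -/
abbrev KHyper := {K : Set X // IsCompact K ∧ K.Nonempty}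

/-- The Vietoris topology on `𝕂(X)`, generated by the sets
`{K : K ⊆ U}` and `{K : K ∩ U ≠ ∅}` for `U` open in `X`. -/
instance (priority := 2000) vietorisTopology : TopologicalSpace (KHyper X) :=
  TopologicalSpace.generateFrom
    ({S | ∃ U : Set X, IsOpen U ∧ S = {K : KHyper X | K.1 ⊆ U}} ∪
     {S | ∃ U : Set X, IsOpen U ∧ S = {K : KHyper X | (K.1 ∩ U).Nonempty}})

/-- `[U] = {K ∈ 𝕂(X) : K ⊆ U}`. -/
def vLower (U : Set X) : Set (KHyper X) := {K | K.1 ⊆ U}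

/-- `P_fin(X)`: the subspace of `𝕂(X)` of nonempty finite subsets of `X`. -/
abbrev PFinH := {K : KHyper X // K.1.Finite}

/-- A family `𝒜` of subsets of `X` viewed as a subspace `𝔸` of `𝕂(X)`. -/
abbrev ASub (𝒜 : Set (Set X)) := {K : KHyper X // K.1 ∈ 𝒜}

end Hyperspace

/-- An ideal of compact proper subsets of a space: closed under finite unions
and under compact subsets. -/
def IsCompactIdealOn {Y : Type*} [TopologicalSpace Y] (ℬ : Set (Set Y)) : Prop :=
  (∀ B ∈ ℬ, IsCompact B ∧ B ≠ Set.univ) ∧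
  (∀ B ∈ ℬ, ∀ C ∈ ℬ, B ∪ C ∈ ℬ) ∧
  (∀ B ∈ ℬ, ∀ C : Set Y, IsCompact C → C ⊆ B → C ∈ ℬ)

/-- `ℬ` witnesses that the ideal `𝒜` of compact subsets of `X` is closed under
`𝒜`-unions: `ℬ` is an ideal of compact subsets of the subspace `𝔸 = 𝒜` of
`𝕂(X)` such that (i) for every `K₀ ∈ 𝒜`, `{K ∈ 𝔸 : K ⊆ K₀} ∈ ℬ`, and
(ii) for every `KK ∈ ℬ`, `⋃ KK ∈ 𝒜`. -/
def WitnessesAUnions {X : Type*} [TopologicalSpace X] (𝒜 : Set (Set X))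
    (ℬ : Set (Set (ASub X 𝒜))) : Prop :=
  IsCompactIdealOn ℬ ∧
  (∀ K₀ ∈ 𝒜, {K : ASub X 𝒜 | K.1.1 ⊆ K₀} ∈ ℬ) ∧
  (∀ KK ∈ ℬ, (⋃ K ∈ KK, (K : ASub X 𝒜).1.1) ∈ 𝒜)

/-- `X^{≤n}`: the disjoint union of `X, X², …, Xⁿ`. -/
abbrev LePow (X : Type*) (n : ℕ) := Σ i : Fin n, (Fin (i.1 + 1) → X)

/-- `X^{<ω}`: the disjoint union of all finite powers `Xⁿ`, `n ≥ 1`. -/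
abbrev FinPows (X : Type*) := Σ n : ℕ, (Fin (n + 1) → X)

/-- `A^{≤n}`: the copy of the disjoint union of `A, A², …, Aⁿ` inside `X^{≤n}`. -/
def lePowSet {X : Type*} (n : ℕ) (A : Set X) : Set (LePow X n) :=
  {p | ∀ j, p.2 j ∈ A}

/-- `A^{<ω}` inside `X^{<ω}`. -/
def finPowsSet {X : Type*} (A : Set X) : Set (FinPows X) :=
  {p | ∀ j, p.2 j ∈ A}

open Filter Topology

section VietorisCompact

variable {X : Type*} [TopologicalSpace X]

theorem isOpen_vLower {U : Set X} (hU : IsOpen U) : IsOpen (vLower X U) :=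
  TopologicalSpace.isOpen_generateFrom_of_mem (Or.inl ⟨U, hU, rfl⟩)

theorem vLower_ne_univ {U : Set X} (hU : U ≠ univ) : vLower X U ≠ univ := by
  intro h
  refine hU (eq_univ_of_forall fun x => ?_)
  have hx : (⟨{x}, isCompact_singleton, singleton_nonempty x⟩ : KHyper X) ∈ vLower X U :=
    h ▸ mem_univ _
  exact hx rfl

/-- An ultrafilter on the hyperspace that concentrates on every neighbourhood of a compact set `K`
converges to a nonempty compact subset of `K`. -/
theorem exists_le_nhds_of_vLower_mem {K : Set X} (hK : IsCompact K) (f : Ultrafilter (KHyper X))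
    (hf : ∀ U, IsOpen U → K ⊆ U → vLower X U ∈ f) :
    ∃ L : KHyper X, L.1 ⊆ K ∧ (f : Filter (KHyper X)) ≤ 𝓝 L := by
  let N : Set X := ⋃₀ {V | IsOpen V ∧ {M : KHyper X | Disjoint M.1 V} ∈ f}
  have hN : IsOpen N := isOpen_sUnion fun V hV => hV.1
  have key : ∀ V, IsOpen V → K \ N ⊆ V → vLower X V ∈ f := by
    intro V hV hLV
    have hcov : K \ V ⊆ ⋃₀ {V | IsOpen V ∧ {M : KHyper X | Disjoint M.1 V} ∈ f} := by
      intro x hx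
      by_contra hxN
      exact hx.2 (hLV ⟨hx.1, hxN⟩)
    rw [sUnion_eq_biUnion] at hcov
    obtain ⟨T, hT, hTfin, hTcov⟩ := IsCompact.elim_finite_subcover_image (hK.diff hV)
      (fun V hV => hV.1) hcov
    rw [← sUnion_eq_biUnion] at hTcov
    have hdisj : {M : KHyper X | ∀ t ∈ T, Disjoint M.1 t} ∈ f := by
      have := (biInter_mem (f := (f : Filter (KHyper X)))
        (s := fun t => {M : KHyper X | Disjoint M.1 t}) hTfin).2 fun t ht => (hT ht).2
      filter_upwards [this] with M hM t ht
      exact mem_iInter₂.1 hM t ht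
    have hVT := hf (V ∪ ⋃₀ T) (hV.union (isOpen_sUnion fun t ht => (hT ht).1)) fun x hx =>
      or_iff_not_imp_left.2 fun hxV => hTcov ⟨hx, hxV⟩
    filter_upwards [hdisj, hVT] with M hM hMV x hx
    rcases hMV hx with h | ⟨t, ht, hxt⟩
    · exact h
    · exact (disjoint_left.1 (hM t ht) hx hxt).elim
  have hne : (K \ N).Nonempty := by
    by_contra h
    rw [not_nonempty_iff_eq_empty] at h
    obtain ⟨M, hM⟩ := f.nonempty_of_mem (key ∅ isOpen_empty h.subset)
    obtain ⟨x, hx⟩ := M.2.2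
    exact hM hx
  refine ⟨⟨K \ N, hK.diff hN, hne⟩, sdiff_subset, ?_⟩
  rw [TopologicalSpace.nhds_generateFrom]
  refine le_iInf₂ fun S hS => le_principal_iff.2 ?_
  obtain ⟨hmem, ⟨U, hU, rfl⟩ | ⟨U, hU, rfl⟩⟩ := hS
  · exact key U hU hmem
  · obtain ⟨x, hx, hxU⟩ := hmem
    by_contra hnot
    refine hx.2 ⟨U, ⟨hU, ?_⟩, hxU⟩
    filter_upwards [Ultrafilter.compl_mem_iff_notMem.2 hnot] with M hM
    exact not_not.1 fun h => hM (not_disjoint_iff_nonempty_inter.1 h)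

theorem isCompact_vLower {K : Set X} (hK : IsCompact K) : IsCompact (vLower X K) := by
  rw [isCompact_iff_ultrafilter_le_nhds]
  intro f hf
  refine exists_le_nhds_of_vLower_mem hK f fun U _ hKU => ?_
  filter_upwards [le_principal_iff.1 hf] with M hM
  exact hM.trans hKU

theorem exists_isOpen_vLower_subset {K : Set X} (hK : IsCompact K) {W : Set (KHyper X)}
    (hW : IsOpen W) (hKW : vLower X K ⊆ W) :
    ∃ U, IsOpen U ∧ K ⊆ U ∧ vLower X U ⊆ W := by
  by_contra! h
  have hb := ((hasBasis_nhdsSet K).smallSets.comap (Subtype.val : KHyper X → Set X)).inf_principal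
    Wᶜ
  have : NeBot (comap (Subtype.val : KHyper X → Set X) (𝓝ˢ K).smallSets ⊓ 𝓟 Wᶜ) := by
    refine hb.neBot_iff.2 fun {U} hU => ?_
    obtain ⟨M, hM, hMW⟩ := not_subset.1 (h U hU.1 hU.2)
    exact ⟨M, hM, hMW⟩
  have hle := Ultrafilter.of_le (comap (Subtype.val : KHyper X → Set X) (𝓝ˢ K).smallSets ⊓ 𝓟 Wᶜ)
  obtain ⟨L, hLK, hL⟩ := exists_le_nhds_of_vLower_mem hK _ fun U hU hKU =>
    hle (mem_of_superset (hb.mem_of_mem ⟨hU, hKU⟩) fun M hM => hM.1)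
  exact Ultrafilter.compl_notMem_iff.2 (hL (hW.mem_nhds (hKW hLK)))
    (hle (mem_inf_of_right (mem_principal_self _)))

/-- The union of a compact family of compact sets is compact. -/
theorem isCompact_biUnion_of_isCompact {𝓛 : Set (KHyper X)} (h𝓛 : IsCompact 𝓛) :
    IsCompact (⋃ L ∈ 𝓛, L.1) := by
  classical
  refine isCompact_of_finite_subcover fun {ι} U hU hcov => ?_
  have hfin : ∀ L ∈ 𝓛, ∃ T : Finset ι, L.1 ⊆ ⋃ i ∈ T, U i := fun L hL =>
    L.2.1.elim_finite_subcover U hU ((subset_biUnion_of_mem (u := fun L : KHyper X => L.1)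
      hL).trans hcov)
  choose! T hT using hfin
  obtain ⟨t, -, ht⟩ := h𝓛.elim_nhds_subcover (fun L => vLower X (⋃ i ∈ T L, U i)) fun L hL =>
    (isOpen_vLower (isOpen_biUnion fun i _ => hU i)).mem_nhds (hT L hL)
  refine ⟨t.biUnion T, iUnion₂_subset fun L hL x hx => ?_⟩
  obtain ⟨M, hM, hLM⟩ := mem_iUnion₂.1 (ht hL)
  obtain ⟨i, hi, hxi⟩ := mem_iUnion₂.1 (hLM hx)
  exact mem_iUnion₂.2 ⟨i, Finset.mem_biUnion.2 ⟨M, hM, hi⟩, hxi⟩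

theorem ne_univ_of_isCompact_hyperspace (hnc : ¬ IsCompact (univ : Set X)) {𝓛 : Set (KHyper X)}
    (h𝓛 : IsCompact 𝓛) : 𝓛 ≠ univ := by
  rintro rfl
  have hunion : ⋃ L ∈ (univ : Set (KHyper X)), L.1 = univ :=
    eq_univ_of_forall fun x => mem_iUnion₂.2 ?_
  · exact hnc (hunion ▸ isCompact_biUnion_of_isCompact h𝓛)
  exact ⟨⟨{x}, isCompact_singleton, singleton_nonempty x⟩, mem_univ _, rfl⟩

/-- In a non-compact T₁ space every open neighbourhood of a compact set shrinks to a proper one. -/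
theorem exists_isOpen_ne_univ_subset [T1Space X] (hnc : ¬ IsCompact (univ : Set X)) {K U : Set X}
    (hK : IsCompact K) (hU : IsOpen U) (hKU : K ⊆ U) :
    ∃ V, IsOpen V ∧ V ≠ univ ∧ K ⊆ V ∧ V ⊆ U := by
  have hKne : K ≠ univ := by
    rintro rfl
    exact hnc hK
  obtain ⟨p, hp⟩ := (ne_univ_iff_exists_notMem K).1 hKne
  refine ⟨U \ {p}, hU.sdiff isClosed_singleton, ?_, fun x hx => ⟨hKU hx, ?_⟩, sdiff_subset⟩
  · exact fun h => (h.symm ▸ mem_univ p : p ∈ U \ {p}).2 rfl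
  · rintro rfl
    exact hp hx

/-- Open proper sets `U` whose hyperspaces `[U]` satisfy a downward closed property `P` form a
k-cover as soon as every compact set has an open neighbourhood with property `P`. -/
theorem isKCover_setOf [T1Space X] (hnc : ¬ IsCompact (univ : Set X)) {P : Set X → Prop}
    (hP : ∀ U V, V ⊆ U → P U → P V)
    (h : ∀ K, IsCompact K → ∃ U, IsOpen U ∧ K ⊆ U ∧ P U) :
    IsKCover X {U | IsOpen U ∧ U ≠ univ ∧ P U} := by
  have key : ∀ K, IsCompact K → ∃ U ∈ {U | IsOpen U ∧ U ≠ univ ∧ P U}, K ⊆ U := by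
    intro K hK
    obtain ⟨U, hU, hKU, hPU⟩ := h K hK
    obtain ⟨V, hV, hVne, hKV, hVU⟩ := exists_isOpen_ne_univ_subset hnc hK hU hKU
    exact ⟨V, ⟨hV, hVne, hP U V hVU hPU⟩, hKV⟩
  refine ⟨⟨fun U hU => hU.1, eq_univ_of_forall fun x => ?_, fun hu => hu.2.1 rfl⟩,
    fun K hK _ => key K hK⟩
  obtain ⟨U, hU, hxU⟩ := key {x} isCompact_singleton
  exact ⟨U, hU, hxU rfl⟩

theorem IsKCover.exists_subset (hnc : ¬ IsCompact (univ : Set X)) {𝒰 : Set (Set X)}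
    (h𝒰 : IsKCover X 𝒰) {K : Set X} (hK : IsCompact K) : ∃ U ∈ 𝒰, K ⊆ U := by
  refine h𝒰.2 K hK ?_
  rintro rfl
  exact hnc hK

theorem IsKLindelof.isLindelofSp_hyperspace [T1Space X] (hnc : ¬ IsCompact (univ : Set X))
    (hX : IsKLindelof X) : IsLindelofSp (KHyper X) := by
  intro 𝒲 hopen hcov
  have hcover : IsKCover X
      {U | IsOpen U ∧ U ≠ univ ∧ ∃ ℱ ⊆ 𝒲, ℱ.Finite ∧ vLower X U ⊆ ⋃₀ ℱ} := by
    refine isKCover_setOf hnc ?_ fun K hK => ?_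
    · rintro U V hVU ⟨ℱ, hsub, hfin, hℱ⟩
      exact ⟨ℱ, hsub, hfin, fun L hL => hℱ (subset_trans hL hVU)⟩
    · obtain ⟨ℱ, hsub, hfin, hℱ⟩ := IsCompact.elim_finite_subcover_image (c := id)
        (isCompact_vLower hK) hopen
        (by simp only [id, ← sUnion_eq_biUnion, hcov, subset_univ])
      obtain ⟨U, hU, hKU, hUW⟩ := exists_isOpen_vLower_subset hK
        (isOpen_biUnion fun W hW => hopen W (hsub hW)) hℱ
      exact ⟨U, hU, hKU, ℱ, hsub, hfin, hUW.trans_eq sUnion_eq_biUnion.symm⟩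
  obtain ⟨𝒱, h𝒱, hcount, hk⟩ := hX _ hcover
  have hfam : ∀ U ∈ 𝒱, ∃ ℱ ⊆ 𝒲, ℱ.Finite ∧ vLower X U ⊆ ⋃₀ ℱ := fun U hU => (h𝒱 hU).2.2
  choose! ℱ hsub hfin hℱ using hfam
  refine ⟨⋃ U ∈ 𝒱, ℱ U, iUnion₂_subset hsub, hcount.biUnion fun U hU => (hfin U hU).countable,
    eq_univ_of_forall fun L => ?_⟩
  obtain ⟨U, hU, hLU⟩ := hk.exists_subset hnc L.2.1
  obtain ⟨W, hW, hLW⟩ := hℱ U hU hLU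
  exact ⟨W, mem_iUnion₂.2 ⟨U, hU, hW⟩, hLW⟩

theorem IsKLindelof.hyperspace [T1Space X] (hnc : ¬ IsCompact (univ : Set X))
    (hX : IsKLindelof X) : IsKLindelof (KHyper X) := by
  intro 𝒲 h𝒲
  have hcover : IsKCover X {U | IsOpen U ∧ U ≠ univ ∧ ∃ W ∈ 𝒲, vLower X U ⊆ W} := by
    refine isKCover_setOf hnc ?_ fun K hK => ?_
    · rintro U V hVU ⟨W, hW, hUW⟩
      exact ⟨W, hW, fun L hL => hUW (subset_trans hL hVU)⟩
    · have hK' := isCompact_vLower hK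
      obtain ⟨W, hW, hKW⟩ := h𝒲.2 _ hK' (ne_univ_of_isCompact_hyperspace hnc hK')
      obtain ⟨U, hU, hKU, hUW⟩ := exists_isOpen_vLower_subset hK (h𝒲.1.1 W hW) hKW
      exact ⟨U, hU, hKU, W, hW, hUW⟩
  obtain ⟨𝒱, h𝒱, hcount, hk⟩ := hX _ hcover
  have hfam : ∀ U ∈ 𝒱, ∃ W ∈ 𝒲, vLower X U ⊆ W := fun U hU => (h𝒱 hU).2.2
  choose! W hW hUW using hfam
  have hsub : W '' 𝒱 ⊆ 𝒲 := image_subset_iff.2 hW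
  refine ⟨W '' 𝒱, hsub, hcount.image W, ⟨fun V hV => h𝒲.1.1 V (hsub hV),
    eq_univ_of_forall fun L => ?_, fun hu => h𝒲.1.2.2 (hsub hu)⟩, fun 𝓛 h𝓛 _ => ?_⟩
  · obtain ⟨U, hU, hLU⟩ := hk.exists_subset hnc L.2.1
    exact ⟨W U, mem_image_of_mem W hU, hUW U hU hLU⟩
  · obtain ⟨U, hU, hLU⟩ := hk.exists_subset hnc (isCompact_biUnion_of_isCompact h𝓛)
    exact ⟨W U, mem_image_of_mem W hU, fun L hL => hUW U hU ((subset_biUnion_of_mem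
      (u := fun L : KHyper X => L.1) hL).trans hLU)⟩

/-- If countably many of the sets `[U]`, with `U` in a k-cover `𝒰`, cover the hyperspace, then `𝒰`
has a countable subset which is still a k-cover. -/
theorem IsKCover.exists_countable_of_vLower [Nonempty X] {𝒰 : Set (Set X)} (h𝒰 : IsKCover X 𝒰)
    {𝒲 : Set (Set (KHyper X))} (h𝒲 : 𝒲 ⊆ vLower X '' 𝒰) (hcount : 𝒲.Countable)
    (hcov : ⋃₀ 𝒲 = univ) : ∃ 𝒱 ⊆ 𝒰, 𝒱.Countable ∧ IsKCover X 𝒱 := by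
  have hpre : ∀ W ∈ 𝒲, ∃ U ∈ 𝒰, vLower X U = W := fun W hW => h𝒲 hW
  choose! f hf𝒰 hf using hpre
  have hsub : f '' 𝒲 ⊆ 𝒰 := image_subset_iff.2 hf𝒰
  have key : ∀ L : KHyper X, ∃ U ∈ f '' 𝒲, L.1 ⊆ U := by
    intro L
    obtain ⟨W, hW, hLW⟩ : L ∈ ⋃₀ 𝒲 := hcov ▸ mem_univ L
    rw [← hf W hW] at hLW
    exact ⟨f W, mem_image_of_mem f hW, hLW⟩
  have hsingle : ∀ x, ∃ U ∈ f '' 𝒲, {x} ⊆ U := fun x =>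
    key ⟨{x}, isCompact_singleton, singleton_nonempty x⟩
  refine ⟨f '' 𝒲, hsub, hcount.image f, ⟨fun U hU => h𝒰.1.1 U (hsub hU),
    eq_univ_of_forall fun x => ?_, fun hu => h𝒰.1.2.2 (hsub hu)⟩, fun K hK _ => ?_⟩
  · obtain ⟨U, hU, hxU⟩ := hsingle x
    exact ⟨U, hU, hxU rfl⟩
  · rcases K.eq_empty_or_nonempty with rfl | hne
    · obtain ⟨U, hU, -⟩ := hsingle (Classical.arbitrary X)
      exact ⟨U, hU, empty_subset U⟩
    · exact key ⟨K, hK, hne⟩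

theorem isKLindelof_of_isLindelofSp_hyperspace [Nonempty X] (hnc : ¬ IsCompact (univ : Set X))
    (h : IsLindelofSp (KHyper X)) : IsKLindelof X := by
  intro 𝒰 h𝒰
  obtain ⟨𝒲, h𝒲, hcount, hcov⟩ := h (vLower X '' 𝒰)
    (forall_mem_image.2 fun U hU => isOpen_vLower (h𝒰.1.1 U hU))
    (eq_univ_of_forall fun L => by
      obtain ⟨U, hU, hLU⟩ := h𝒰.exists_subset hnc L.2.1
      exact ⟨_, mem_image_of_mem _ hU, hLU⟩)
  exact h𝒰.exists_countable_of_vLower h𝒲 hcount hcov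

theorem isKLindelof_of_hyperspace [Nonempty X] (hnc : ¬ IsCompact (univ : Set X))
    (h : IsKLindelof (KHyper X)) : IsKLindelof X := by
  intro 𝒰 h𝒰
  have hcover : IsKCover (KHyper X) (vLower X '' 𝒰) := by
    refine ⟨⟨forall_mem_image.2 fun U hU => isOpen_vLower (h𝒰.1.1 U hU),
      eq_univ_of_forall fun L => ?_, ?_⟩, fun 𝓛 h𝓛 _ => ?_⟩
    · obtain ⟨U, hU, hLU⟩ := h𝒰.exists_subset hnc L.2.1
      exact ⟨_, mem_image_of_mem _ hU, hLU⟩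
    · rintro ⟨U, hU, hUuniv⟩
      refine vLower_ne_univ ?_ hUuniv
      rintro rfl
      exact h𝒰.1.2.2 hU
    · obtain ⟨U, hU, hLU⟩ := h𝒰.exists_subset hnc (isCompact_biUnion_of_isCompact h𝓛)
      exact ⟨_, mem_image_of_mem _ hU, fun L hL => (subset_biUnion_of_mem
        (u := fun L : KHyper X => L.1) hL).trans hLU⟩
  obtain ⟨𝒲, h𝒲, hcount, hk⟩ := h _ hcover
  exact h𝒰.exists_countable_of_vLower h𝒲 hcount hk.1.2.1

end VietorisCompact

/-- For any infinite, non-compact Hausdorff space `X`, the following are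
equivalent: (a) `X` is k-Lindelöf; (b) `𝕂(X)` is k-Lindelöf;
(c) `𝕂(X)` is Lindelöf. -/
theorem statement16 {X : Type*} [TopologicalSpace X] [T2Space X] [Infinite X]
    (hnc : ¬ IsCompact (Set.univ : Set X)) :
    (IsKLindelof X ↔ IsKLindelof (KHyper X)) ∧
    (IsKLindelof (KHyper X) ↔ IsLindelofSp (KHyper X)) := by
  exact ⟨⟨fun h => h.hyperspace hnc, isKLindelof_of_hyperspace hnc⟩,
    fun h => (isKLindelof_of_hyperspace hnc h).isLindelofSp_hyperspace hnc,
    fun h => (isKLindelof_of_isLindelofSp_hyperspace hnc h).hyperspace hnc⟩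
end

section
/- Let X be a Hausdorff space and let 𝒜 be an ideal of closed proper subsets of X (closed under finite unions) that contains all singletons. Suppose ⋃{ ℱ_n : n ∈ ω } is an 𝒜-cover of X, where each ℱ_n is a finite collection of open sets. Then for every A ∈ 𝒜 there exists a strictly increasing sequence ⟨α_n : n ∈ ω⟩ of natural numbers such that for every n ∈ ω there is U ∈ ℱ_{α_n} with A ⊆ U. -/
open Set

/-- A union-closed family containing all singletons absorbs one point from the complement of each
member of a finite family of proper subsets. -/
theorem exists_superset_not_subset_of_finite {X : Type*} {𝒜 : Set (Set X)}
    (hunion : ∀ A ∈ 𝒜, ∀ B ∈ 𝒜, A ∪ B ∈ 𝒜) (hsing : ∀ x : X, {x} ∈ 𝒜)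
    {A : Set X} (hA : A ∈ 𝒜) {G : Set (Set X)} (hG : G.Finite) (huniv : Set.univ ∉ G) :
    ∃ B ∈ 𝒜, A ⊆ B ∧ ∀ V ∈ G, ¬ B ⊆ V := by
  induction G, hG using Set.Finite.induction_on with
  | empty => exact ⟨A, hA, Subset.rfl, by simp⟩
  | @insert V G _ _ ih =>
    obtain ⟨B, hB, hAB, hBG⟩ := ih fun h => huniv (Or.inr h)
    have hV : V ≠ Set.univ := fun h => huniv (Or.inl h.symm)
    obtain ⟨x, hx⟩ := (Set.ne_univ_iff_exists_notMem V).1 hV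
    refine ⟨B ∪ {x}, hunion B hB _ (hsing x), hAB.trans subset_union_left, ?_⟩
    rintro W (rfl | hW) hBW
    · exact hx (hBW (Or.inr rfl))
    · exact hBG W hW (subset_union_left.trans hBW)

/-- If `𝒜` is an ideal of closed proper subsets of `X` containing all
singletons and `⋃_{n} ℱ_n` is an `𝒜`-cover of `X`, where each `ℱ_n` is a finite
collection of open sets, then for every `A ∈ 𝒜` there is a strictly increasing
sequence `⟨α_n⟩` such that for every `n` some `U ∈ ℱ_{α_n}` contains `A`. -/
theorem statement17 {X : Type*} [TopologicalSpace X] [T2Space X]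
    (𝒜 : Set (Set X))
    (hclosed : ∀ A ∈ 𝒜, IsClosed A ∧ A ≠ Set.univ)
    (hunion : ∀ A ∈ 𝒜, ∀ B ∈ 𝒜, A ∪ B ∈ 𝒜)
    (hsub : ∀ A ∈ 𝒜, ∀ B : Set X, IsClosed B → B ⊆ A → B ∈ 𝒜)
    (hsing : ∀ x : X, {x} ∈ 𝒜)
    (ℱ : ℕ → Set (Set X)) (hfin : ∀ n, (ℱ n).Finite)
    (hcov : IsACover X 𝒜 (⋃ n, ℱ n)) :
    ∀ A ∈ 𝒜, ∃ α : ℕ → ℕ, StrictMono α ∧ ∀ n, ∃ U ∈ ℱ (α n), A ⊆ U := by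
  intro A hA
  refine Filter.extraction_of_frequently_atTop (P := fun n => ∃ U ∈ ℱ n, A ⊆ U)
    (Filter.frequently_atTop.2 fun N => ?_)
  obtain ⟨⟨-, -, huniv⟩, hcover⟩ := hcov
  obtain ⟨B, hB, hAB, hBG⟩ := exists_superset_not_subset_of_finite hunion hsing hA
    ((Set.finite_Iio N).biUnion fun n _ => hfin n)
    fun h => huniv (iUnion₂_subset (fun n _ => subset_iUnion ℱ n) h)
  obtain ⟨U, hU, hBU⟩ := hcover B hB
  obtain ⟨m, hm⟩ := mem_iUnion.1 hU
  refine ⟨m, not_lt.1 fun hmN => hBG U (mem_biUnion hmN hm) hBU, U, hm, hAB.trans hBU⟩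
end

section
/- For any infinite, non-compact Hausdorff space X: One has a winning predetermined strategy in the game G_1(K_X, K_X) if and only if One has a winning (full-information) strategy in G_1(K_X, K_X). Equivalently, if X satisfies S_1(K,K) (i.e., for every sequence ⟨𝒰_n : n ∈ ω⟩ of k-covers of X there exist U_n ∈ 𝒰_n with {U_n : n ∈ ω} a k-cover of X), then for every strategy σ for One in G_1(K_X,K_X) there is a play by Two defeating σ. -/
open Set

/-- Every sequence of open covers of `P` admits a selection of one member from each cover
which is again a cover. -/
def IsRothberger (P : Type*) [TopologicalSpace P] : Prop :=
  ∀ 𝒲 : ℕ → Set (Set P), (∀ n, ∀ W ∈ 𝒲 n, IsOpen W) → (∀ n p, ∃ W ∈ 𝒲 n, p ∈ W) →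
    ∃ W : ℕ → Set P, (∀ n, W n ∈ 𝒲 n) ∧ ∀ p, ∃ n, p ∈ W n

/-- The lists of natural numbers of length at most `m` with entries at most `m`. -/
def boundedLists (m : ℕ) : Set (List ℕ) := {s | s.length ≤ m ∧ ∀ a ∈ s, a ≤ m}

theorem finite_boundedLists (m : ℕ) : (boundedLists m).Finite := by
  refine ((List.finite_length_le (Fin (m + 1)) m).image (List.map Fin.val)).subset ?_
  rintro s ⟨hl, hs⟩
  refine ⟨s.attach.map fun a => ⟨a.1, Nat.lt_succ_of_le (hs a.1 a.2)⟩, by simpa using hl, ?_⟩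
  simp [List.map_map, Function.comp_def]

theorem boundedLists_mono : Monotone boundedLists :=
  fun _ _ h _ hs => ⟨hs.1.trans h, fun a ha => (hs.2 a ha).trans h⟩

/-- The initial segment of length `n` of `f`, in reverse order. -/
def revPrefix {α : Type*} (f : ℕ → α) : ℕ → List α
  | 0 => []
  | n + 1 => f n :: revPrefix f n

theorem revPrefix_mem_boundedLists {f h : ℕ → ℕ} (hh : StrictMono h)
    (hf : ∀ n, f n ≤ h (n + 1)) (n : ℕ) : revPrefix f n ∈ boundedLists (h n) := by
  induction n with
  | zero => exact ⟨Nat.zero_le _, by simp [revPrefix]⟩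
  | succ n ih =>
    have hlt : h n < h (n + 1) := hh n.lt_succ_self
    refine ⟨by simpa [revPrefix] using ih.1.trans_lt hlt, fun a ha => ?_⟩
    rcases List.mem_cons.1 ha with rfl | ha
    · exact hf n
    · exact (ih.2 a ha).trans hlt.le

namespace IsRothberger

variable {P : Type*} [TopologicalSpace P]

theorem exists_index (hP : IsRothberger P) {ι : Type*} (V : ℕ → ι → Set P)
    (hV : ∀ n i, IsOpen (V n i)) (hcov : ∀ n p, ∃ i, p ∈ V n i) :
    ∃ i : ℕ → ι, ∀ p, ∃ n, p ∈ V n (i n) := by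
  obtain ⟨W, hW, hWc⟩ := hP (fun n => range (V n)) (by rintro n _ ⟨i, rfl⟩; exact hV n i)
    (fun n p => by simpa using hcov n p)
  choose i hi using hW
  exact ⟨i, fun p => (hWc p).imp fun n hn => by rwa [hi]⟩

/-- The Menger property for increasing covers, in the form where each point is covered
infinitely often. -/
theorem exists_frequently_mem (hP : IsRothberger P) (H : ℕ → ℕ → Set P)
    (hopen : ∀ m k, IsOpen (H m k)) (hmono : ∀ m, Monotone (H m))
    (hcov : ∀ m p, ∃ k, p ∈ H m k) :
    ∃ g : ℕ → ℕ, ∀ p N, ∃ m ≥ N, p ∈ H m (g m) := by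
  choose g hg using fun N => hP.exists_index (fun n => H (N + n)) (fun n => hopen (N + n))
    (fun n => hcov (N + n))
  refine ⟨fun m => ∑ N ∈ Finset.range (m + 1), g N (m - N), fun p N => ?_⟩
  obtain ⟨n, hn⟩ := hg N p
  refine ⟨N + n, by omega, hmono _ ?_ hn⟩
  have := Finset.single_le_sum (f := fun M => g M (N + n - M)) (fun _ _ => Nat.zero_le _)
    (show N ∈ Finset.range (N + n + 1) by simp)
  simpa using this

/-- One can select from families of open sets which together cover each point infinitely often,
even if the individual families are not covers. -/
theorem exists_index_of_frequently (hP : IsRothberger P) {ι : Type*} [Nonempty ι]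
    (V : ℕ → ι → Set P) (hV : ∀ n i, IsOpen (V n i)) (hcov : ∀ p N, ∃ n ≥ N, ∃ i, p ∈ V n i) :
    ∃ i : ℕ → ι, ∀ p, ∃ n, p ∈ V n (i n) := by
  classical
  obtain ⟨W, hW, hWc⟩ := hP
    (fun m => {W | ∃ S : Finset ℕ, S.card = m + 1 ∧ ∃ φ : ℕ → ι, W = ⋂ n ∈ S, V n (φ n)})
    (by
      rintro m _ ⟨S, -, φ, rfl⟩
      exact isOpen_biInter_finset fun n _ => hV n _)
    (by
      intro m p
      have hinf : {n | ∃ i, p ∈ V n i}.Infinite := Set.infinite_of_not_bddAbove fun ⟨b, hb⟩ => by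
        obtain ⟨n, hn, hi⟩ := hcov p (b + 1)
        have := hb hi
        omega
      obtain ⟨S, hS, hcard⟩ := hinf.exists_subset_card_eq (m + 1)
      have : ∀ n, ∃ i, n ∈ S → p ∈ V n i := fun n => by
        by_cases hn : n ∈ S
        · exact (hS hn).imp fun _ h _ => h
        · exact ⟨Classical.arbitrary ι, fun h => absurd h hn⟩
      choose φ hφ using this
      exact ⟨_, ⟨S, hcard, φ, rfl⟩, by simpa using hφ⟩)
  choose S hS φ hφ using hW
  obtain ⟨r, hr, hrS⟩ := (Finset.all_card_le_biUnion_card_iff_exists_injective S).1 fun s => by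
    rcases s.eq_empty_or_nonempty with rfl | hs
    · simp
    calc s.card ≤ (Finset.range (s.max' hs + 1)).card :=
          Finset.card_le_card fun a ha => by simpa [Nat.lt_succ_iff] using s.le_max' a ha
      _ = (S (s.max' hs)).card := by rw [hS, Finset.card_range]
      _ ≤ _ := Finset.card_le_card (Finset.subset_biUnion_of_mem S (s.max'_mem hs))
  refine ⟨fun n => φ (Function.invFun r n) n, fun p => ?_⟩
  obtain ⟨m, hm⟩ := hWc p
  refine ⟨r m, ?_⟩
  simp only [Function.leftInverse_invFun hr m]
  rw [hφ] at hm
  exact Set.mem_iInter₂.1 hm _ (hrS m)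

/-- An iterated form of the Menger property: the bound `h (n + 1)` is compared with the cover
of index `h n`. -/
theorem exists_strictMono_frequently_mem (hP : IsRothberger P) (G : ℕ → ℕ → Set P)
    (hopen : ∀ m k, IsOpen (G m k)) (hanti : ∀ k, Antitone fun m => G m k)
    (hmono : ∀ m, Monotone (G m)) (hcov : ∀ m p, ∃ k, p ∈ G m k) :
    ∃ h : ℕ → ℕ, StrictMono h ∧ ∀ p N, ∃ n ≥ N, p ∈ G (h n) (h (n + 1)) := by
  obtain ⟨g, hg⟩ := hP.exists_frequently_mem (fun m k => ⋃ l, G m l ∩ G l k)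
    (fun m k => isOpen_iUnion fun l => (hopen m l).inter (hopen l k))
    (fun m k k' hk => iUnion_mono fun l => inter_subset_inter_right _ (hmono l hk))
    (fun m p => by
      obtain ⟨l, hl⟩ := hcov m p
      obtain ⟨k, hk⟩ := hcov l p
      exact ⟨k, mem_iUnion.2 ⟨l, hl, hk⟩⟩)
  let step : ℕ → ℕ := fun a => a + 1 + ∑ i ∈ Finset.range (a + 1), g i
  let h : ℕ → ℕ := fun n => step^[n] 0
  have hsucc : ∀ n, h (n + 1) = step (h n) := fun n => Function.iterate_succ_apply' step n 0
  have hh : StrictMono h := strictMono_nat_of_lt_succ fun n => by rw [hsucc]; simp only [step]; omega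
  have hgle : ∀ n, ∀ m ≤ h n, g m ≤ h (n + 1) := fun n m hm => by
    have := Finset.single_le_sum (f := g) (fun _ _ => Nat.zero_le _)
      (show m ∈ Finset.range (h n + 1) by simp; omega)
    rw [hsucc]
    simp only [step]
    omega
  refine ⟨h, hh, fun p N => ?_⟩
  by_contra! hbad
  obtain ⟨m, hm, hpm⟩ := hg p (h N)
  obtain ⟨l, hl, hlk⟩ := mem_iUnion.1 hpm
  obtain ⟨n, hn, hnm, hmn⟩ : ∃ n ≥ N, h n ≤ m ∧ m ≤ h (n + 1) := by
    have hex : ∃ n, m < h n := ⟨m + 1, hh.le_apply⟩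
    have hspec := Nat.find_spec hex
    have hlt : N < Nat.find hex := hh.lt_iff_lt.1 (hm.trans_lt hspec)
    refine ⟨Nat.find hex - 1, by omega, not_lt.1 (Nat.find_min hex (by omega)), ?_⟩
    rw [Nat.sub_add_cancel (by omega)]
    exact hspec.le
  have hlt : h (n + 1) < l := by
    by_contra! hle
    exact hbad n hn (hmono _ hle (hanti l hnm hl))
  exact hbad (n + 1) (by omega) (hmono _ (hgle (n + 1) m hmn) (hanti _ hlt.le hlk))

/-- **Pawlikowski's theorem**: in a Rothberger space, every tree of countable open covers has a
branch which is a cover. Nodes are recorded as reversed lists. -/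
theorem exists_branch (hP : IsRothberger P) (c : List ℕ → ℕ → Set P)
    (hopen : ∀ s k, IsOpen (c s k)) (hcov : ∀ s p, ∃ k, p ∈ c s k) :
    ∃ f : ℕ → ℕ, ∀ p, ∃ n, p ∈ c (revPrefix f n) (f n) := by
  obtain ⟨h, hh, hgood⟩ := hP.exists_strictMono_frequently_mem
    (fun m k => ⋂ s ∈ boundedLists m, ⋃ j ≤ k, c s j)
    (fun m k => (finite_boundedLists m).isOpen_biInter fun s _ =>
      isOpen_biUnion fun j _ => hopen s j)
    (fun k m m' hm => biInter_mono (boundedLists_mono hm) fun _ _ => subset_rfl)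
    (fun m k k' hk => iInter₂_mono fun s _ => biUnion_mono (fun j hj => le_trans hj hk)
      fun _ _ => subset_rfl)
    (fun m p => by
      choose κ hκ using fun s => hcov s p
      obtain ⟨k, hk⟩ := ((finite_boundedLists m).image κ).bddAbove
      exact ⟨k, mem_iInter₂.2 fun s hs => mem_iUnion₂.2 ⟨κ s, hk (mem_image_of_mem κ hs), hκ s⟩⟩)
  obtain ⟨φ, hφ⟩ := hP.exists_index_of_frequently
    (fun n (φ : List ℕ → ℕ) => ⋂ s ∈ boundedLists (h n), c s (min (φ s) (h (n + 1))))
    (fun n φ => (finite_boundedLists _).isOpen_biInter fun s _ => hopen s _)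
    (fun p N => by
      obtain ⟨n, hn, hp⟩ := hgood p N
      have : ∀ s, ∃ j, s ∈ boundedLists (h n) → j ≤ h (n + 1) ∧ p ∈ c s j := fun s => by
        by_cases hs : s ∈ boundedLists (h n)
        · obtain ⟨j, hj, hpj⟩ := mem_iUnion₂.1 (mem_iInter₂.1 hp s hs)
          exact ⟨j, fun _ => ⟨hj, hpj⟩⟩
        · exact ⟨0, fun h => absurd h hs⟩
      choose φ hφ using this
      refine ⟨n, hn, φ, mem_iInter₂.2 fun s hs => ?_⟩
      rw [min_eq_left (hφ s hs).1]
      exact (hφ s hs).2)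
  let node : ℕ → List ℕ := Nat.rec [] fun n s => min (φ n s) (h (n + 1)) :: s
  let f : ℕ → ℕ := fun n => min (φ n (node n)) (h (n + 1))
  have hnode : ∀ n, revPrefix f n = node n := fun n => by
    induction n with
    | zero => rfl
    | succ n ih => rw [revPrefix, ih]
  refine ⟨f, fun p => ?_⟩
  obtain ⟨n, hn⟩ := hφ p
  have := mem_iInter₂.1 hn _
    (revPrefix_mem_boundedLists (f := f) hh (fun n => min_le_right _ _) n)
  exact ⟨n, by rwa [hnode n] at this ⊢⟩

end IsRothberger

/-- The compact subsets of `X`, to be endowed with the upper Vietoris topology. -/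
def CompactSubset (X : Type*) [TopologicalSpace X] := {K : Set X // IsCompact K}

/-- The upper Vietoris topology, with base the sets `{K | K ⊆ U}` for `U` open. -/
instance upperVietoris (X : Type*) [TopologicalSpace X] : TopologicalSpace (CompactSubset X) where
  IsOpen W := ∀ K ∈ W, ∃ U, IsOpen U ∧ K.1 ⊆ U ∧ ∀ L : CompactSubset X, L.1 ⊆ U → L ∈ W
  isOpen_univ K _ := ⟨univ, isOpen_univ, subset_univ _, fun _ _ => mem_univ _⟩
  isOpen_inter W W' hW hW' K hK := by
    obtain ⟨U, hU, hKU, h⟩ := hW K hK.1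
    obtain ⟨U', hU', hKU', h'⟩ := hW' K hK.2
    exact ⟨U ∩ U', hU.inter hU', subset_inter hKU hKU', fun L hL =>
      ⟨h L (hL.trans inter_subset_left), h' L (hL.trans inter_subset_right)⟩⟩
  isOpen_sUnion 𝒲 h𝒲 K hK := by
    obtain ⟨W, hW, hKW⟩ := hK
    obtain ⟨U, hU, hKU, h⟩ := h𝒲 W hW K hKW
    exact ⟨U, hU, hKU, fun L hL => ⟨W, hW, h L hL⟩⟩

section KCovers

variable {X : Type*} [TopologicalSpace X]

theorem isOpen_setOf_subset {U : Set X} (hU : IsOpen U) :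
    IsOpen {K : CompactSubset X | K.1 ⊆ U} :=
  fun _ hK => ⟨U, hU, hK, fun _ hL => hL⟩

theorem isKCover_iff (hnc : ¬ IsCompact (univ : Set X)) {𝒰 : Set (Set X)} :
    IsKCover X 𝒰 ↔ (∀ U ∈ 𝒰, IsOpen U) ∧ univ ∉ 𝒰 ∧ ∀ K, IsCompact K → ∃ U ∈ 𝒰, K ⊆ U := by
  constructor
  · rintro ⟨⟨hopen, -, huniv⟩, hK⟩
    exact ⟨hopen, huniv, fun K hc => hK K hc fun h => hnc (h ▸ hc)⟩
  · rintro ⟨hopen, huniv, hK⟩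
    refine ⟨⟨hopen, eq_univ_of_forall fun x => ?_, huniv⟩, fun K hc _ => hK K hc⟩
    obtain ⟨U, hU, hx⟩ := hK {x} isCompact_singleton
    exact ⟨U, hU, hx rfl⟩

theorem isRothberger_compactSubset [T1Space X] (hnc : ¬ IsCompact (univ : Set X))
    (hS : S1 (kCovers X) (kCovers X)) : IsRothberger (CompactSubset X) := by
  intro 𝒲 hopen hcov
  obtain ⟨U, hU, hUk⟩ := hS
    (fun n => {U | IsOpen U ∧ U ≠ univ ∧ ∃ W ∈ 𝒲 n, ∀ K : CompactSubset X, K.1 ⊆ U → K ∈ W})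
    (fun n => (isKCover_iff hnc).2 ⟨fun U hU => hU.1, fun h => h.2.1 rfl, fun K hK => by
      obtain ⟨W, hW, hKW⟩ := hcov n ⟨K, hK⟩
      obtain ⟨U, hU, hKU, hUW⟩ := hopen n W hW _ hKW
      obtain ⟨x, hx⟩ : ∃ x, x ∉ K := by
        by_contra! h
        exact hnc (eq_univ_of_forall h ▸ hK)
      refine ⟨U \ {x}, ⟨hU.sdiff isClosed_singleton, fun h => ?_, W, hW, fun L hL =>
        hUW L (hL.trans sdiff_subset)⟩, subset_sdiff_singleton hKU hx⟩
      exact (h ▸ mem_univ x : x ∈ U \ {x}).2 rfl⟩)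
  choose W hW hUW using fun n => (hU n).2.2
  refine ⟨W, hW, fun K => ?_⟩
  obtain ⟨_, ⟨n, rfl⟩, hn⟩ := ((isKCover_iff hnc).1 hUk).2.2 K.1 K.2
  exact ⟨n, hUW n K hn⟩

theorem not_oneWin1_of_isRothberger (hnc : ¬ IsCompact (univ : Set X))
    (hP : IsRothberger (CompactSubset X)) : ¬ OneWin1 (kCovers X) (kCovers X) := by
  rintro ⟨σ, hσ, hwin⟩
  have hσ' := fun l => (isKCover_iff hnc).1 (hσ l)
  have hLindelof : ∀ l, ∃ e : ℕ → Set X, (∀ k, e k ∈ σ l) ∧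
      ∀ K : CompactSubset X, ∃ k, K.1 ⊆ e k := fun l => by
    obtain ⟨i, hi⟩ := hP.exists_index
      (fun _ (U : σ l) => {K : CompactSubset X | K.1 ⊆ U.1})
      (fun _ U => isOpen_setOf_subset ((hσ' l).1 U.1 U.2))
      (fun _ K => by
        obtain ⟨U, hU, hKU⟩ := (hσ' l).2.2 K.1 K.2
        exact ⟨⟨U, hU⟩, hKU⟩)
    exact ⟨fun k => i k, fun k => (i k).2, hi⟩
  choose e he hecov using hLindelof
  let history : List ℕ → List (Set X) := fun s => List.rec [] (fun k _ l => l ++ [e l k]) s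
  obtain ⟨f, hf⟩ := hP.exists_branch
    (fun s k => {K : CompactSubset X | K.1 ⊆ e (history s) k})
    (fun s k => isOpen_setOf_subset ((hσ' _).1 _ (he _ k)))
    (fun s K => hecov _ K)
  let x : ℕ → Set X := fun n => e (history (revPrefix f n)) (f n)
  have hx : ∀ n, List.ofFn (fun i : Fin n => x i) = history (revPrefix f n) := fun n => by
    induction n with
    | zero => rfl
    | succ n ih =>
      rw [List.ofFn_succ', List.concat_eq_append]
      simp only [Fin.val_castSucc, Fin.val_last]
      rw [ih]
      rfl
  refine hwin x (fun n => hx n ▸ he _ _) ((isKCover_iff hnc).2 ⟨?_, ?_, fun K hK => ?_⟩)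
  · rintro _ ⟨n, rfl⟩
    exact (hσ' _).1 _ (he _ _)
  · rintro ⟨n, hn⟩
    have hmem : x n ∈ σ _ := he (history (revPrefix f n)) (f n)
    exact (hσ' _).2.1 (hn ▸ hmem)
  · obtain ⟨n, hn⟩ := hf ⟨K, hK⟩
    exact ⟨x n, mem_range_self n, hn⟩

end KCovers

/-- Pawlikowski-style strategy reduction for the k-Rothberger game: for any
infinite, non-compact Hausdorff space `X`, One has a winning predetermined
strategy in `G_1(K_X, K_X)` if and only if One has a winning full-information
strategy in `G_1(K_X, K_X)`. -/
theorem statement18 {X : Type*} [TopologicalSpace X] [T2Space X] [Infinite X]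
    (hnc : ¬ IsCompact (Set.univ : Set X)) :
    OnePre1 (kCovers X) (kCovers X) ↔ OneWin1 (kCovers X) (kCovers X) := by
  constructor
  · rintro ⟨σ, hσ, hwin⟩
    exact ⟨fun l => σ l.length, fun _ => hσ _, fun x hx => hwin x fun n => by simpa using hx n⟩
  · contrapose
    intro hpre
    refine not_oneWin1_of_isRothberger hnc (isRothberger_compactSubset hnc fun a ha => ?_)
    by_contra! h
    exact hpre ⟨a, ha, h⟩
end
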